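/- Let ℓ ≥ 3 be an odd integer, let c₁ < 0 and f(x) = |x|^ℓ + c₁ as a map ℝ → ℝ. Assume: (i) there is an integer q ≥ 1 with f^{q+1}(0) = 0 and f^j(0) ≠ 0 for 1 ≤ j ≤ q; (ii) w > 0 satisfies w^ℓ + c₁ = −w (so −w is an orientation-reversing fixed point of f); (iii) f^j(0) ∉ [−w, 0) for all 1 ≤ j ≤ q; (iv) writing c_i = f^i(0), one has c₂ > c₃ > c₄ > 0. Then ∑_{n=0}^{q} 1/Df^n(c₁) > 0, where Df^n(c₁) := ∏_{k=0}^{n−1} f′(f^k(c₁)) (with Df^0(c₁) = 1). -/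

import Mathlib

/-- The map `f(x) = |x|^ℓ + c₁` with `ℓ` an odd integer. -/
noncomputable def oddMap (ℓ : ℕ) (c₁ : ℝ) (x : ℝ) : ℝ := |x| ^ ℓ + c₁

lemma cos_nat_mul_le (n : ℕ) (φ : ℝ) (h0 : 0 ≤ φ) (h : n * φ ≤ Real.pi / 2) :
    Real.cos (n * φ) ≤ Real.cos φ ^ n := by
  induction n with
  | zero => simp
  | succ n ih =>
    push_cast at h ⊢
    have hn : 0 ≤ (n : ℝ) * φ := by positivity
    have h1 : (n : ℝ) * φ ≤ Real.pi / 2 := by nlinarith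
    have hφ : φ ≤ Real.pi / 2 := by nlinarith
    have i1 := ih h1
    have hc : 0 ≤ Real.cos φ := Real.cos_nonneg_of_mem_Icc ⟨by linarith [Real.pi_pos], hφ⟩
    have s1 : 0 ≤ Real.sin φ := Real.sin_nonneg_of_nonneg_of_le_pi h0 (by linarith [Real.pi_pos])
    have s2 : 0 ≤ Real.sin (n * φ) :=
      Real.sin_nonneg_of_nonneg_of_le_pi hn (by linarith [Real.pi_pos])
    have : ((n : ℝ) + 1) * φ = n * φ + φ := by ring
    rw [this, Real.cos_add, pow_succ]
    nlinarith [mul_le_mul_of_nonneg_right i1 hc, mul_nonneg s2 s1]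

lemma cpow_root_form (z : ℂ) (hz : z ≠ 0) (n : ℕ) (hn : n ≠ 0) :
    ∃ R : ℝ, 0 < R ∧ R ^ n = ‖z‖ ∧ (z ^ (1 / (n : ℂ))).re = R * Real.cos (z.arg / n) ∧
      (z ^ (1 / (n : ℂ))).im = R * Real.sin (z.arg / n) ∧ ‖z ^ (1 / (n : ℂ))‖ = R := by
  have hn' : (n : ℝ) ≠ 0 := by exact_mod_cast hn
  have hnc : (n : ℂ) ≠ 0 := by exact_mod_cast hn
  have hzp : 0 < ‖z‖ := norm_pos_iff.mpr hz
  have key : z ^ (1 / (n : ℂ)) = Complex.exp (((Real.log ‖z‖ / n : ℝ) : ℂ) +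
      ((z.arg / n : ℝ) : ℂ) * Complex.I) := by
    rw [Complex.cpow_def_of_ne_zero hz]
    congr 1
    apply Complex.ext <;> simp [Complex.log_re, Complex.log_im, ← Complex.ofReal_natCast, div_eq_mul_inv, ← Complex.ofReal_inv]
  refine ⟨Real.exp (Real.log ‖z‖ / n), Real.exp_pos _, ?_, ?_, ?_, ?_⟩
  · rw [← Real.exp_nat_mul, mul_div_cancel₀ _ hn', Real.exp_log hzp]
  · rw [key, Complex.exp_re]
    simp only [Complex.add_re, Complex.add_im, Complex.ofReal_re, Complex.ofReal_im,
      Complex.mul_re, Complex.mul_im, Complex.I_re, Complex.I_im]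
    ring_nf
  · rw [key, Complex.exp_im]
    simp only [Complex.add_re, Complex.add_im, Complex.ofReal_re, Complex.ofReal_im,
      Complex.mul_re, Complex.mul_im, Complex.I_re, Complex.I_im]
    ring_nf
  · rw [key, Complex.norm_exp]
    simp only [Complex.add_re, Complex.add_im, Complex.ofReal_re, Complex.ofReal_im,
      Complex.mul_re, Complex.mul_im, Complex.I_re, Complex.I_im]
    ring_nf

lemma cpow_root_pow (z : ℂ) (n : ℕ) (hn : n ≠ 0) : (z ^ (1 / (n : ℂ))) ^ n = z := by
  rw [one_div]; exact Complex.cpow_nat_inv_pow z hn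

lemma root_re (z : ℂ) (hz : 0 < z.re) (n : ℕ) (hn : 3 ≤ n) :
    0 < (z ^ (1 / (n : ℂ))).re ∧ z.re ≤ (z ^ (1 / (n : ℂ))).re ^ n ∧
    3 * (z ^ (1 / (n : ℂ))).im ^ 2 < (z ^ (1 / (n : ℂ))).re ^ 2 := by
  have hz0 : z ≠ 0 := by rintro rfl; simp at hz
  obtain ⟨R, hR, hRn, hre, him, hno⟩ := cpow_root_form z hz0 n (by omega)
  have hn' : (3 : ℝ) ≤ n := by exact_mod_cast hn
  have ha : |z.arg| < Real.pi / 2 := Complex.abs_arg_lt_pi_div_two_iff.mpr (Or.inl hz)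
  have hφ : |z.arg / n| < Real.pi / 6 := by
    rw [abs_div, abs_of_pos (by linarith : (0 : ℝ) < n), div_lt_iff₀ (by linarith)]
    nlinarith [Real.pi_pos]
  have hcos : Real.cos (Real.pi / 6) < Real.cos (z.arg / n) := by
    rw [← Real.cos_abs (z.arg / n)]
    exact Real.cos_lt_cos_of_nonneg_of_le_pi (abs_nonneg _) (by linarith [Real.pi_pos]) hφ
  have h3 : 0 < Real.sqrt 3 := by positivity
  have h33 : Real.sqrt 3 ^ 2 = 3 := Real.sq_sqrt (by norm_num)
  rw [Real.cos_pi_div_six] at hcos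
  have hcp : 0 < Real.cos (z.arg / n) := by linarith
  refine ⟨by rw [hre]; positivity, ?_, ?_⟩
  · rw [hre, mul_pow, hRn]
    have h1 := cos_nat_mul_le n |z.arg / n| (abs_nonneg _) (by
      rw [abs_div, abs_of_pos (by linarith : (0 : ℝ) < n), mul_div_cancel₀ _ (by linarith)]
      exact ha.le)
    rw [Real.cos_abs, abs_div, abs_of_pos (by linarith : (0 : ℝ) < n),
      mul_div_cancel₀ _ (by linarith), Real.cos_abs] at h1
    calc z.re = ‖z‖ * Real.cos z.arg := (Complex.norm_mul_cos_arg z).symm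
      _ ≤ _ := by gcongr
  · rw [hre, him, mul_pow, mul_pow]
    have := Real.sin_sq_add_cos_sq (z.arg / n)
    have h4 : 3 / 4 < Real.cos (z.arg / n) ^ 2 := by nlinarith
    have : 3 * Real.sin (z.arg / n) ^ 2 < Real.cos (z.arg / n) ^ 2 := by linarith
    nlinarith [pow_pos hR 2]

lemma root_im (z : ℂ) (hz : 0 < z.re) (hz3 : 3 * z.im ^ 2 < z.re ^ 2) (n : ℕ) (hn : 3 ≤ n) :
    |(z ^ (1 / (n : ℂ))).im| ≤ ‖z ^ (1 / (n : ℂ))‖ * (Real.pi / 18) := by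
  have hz0 : z ≠ 0 := by rintro rfl; simp at hz
  obtain ⟨R, hR, hRn, hre, him, hno⟩ := cpow_root_form z hz0 n (by omega)
  have hn' : (3 : ℝ) ≤ n := by exact_mod_cast hn
  have ha : |z.arg| < Real.pi / 2 := Complex.abs_arg_lt_pi_div_two_iff.mpr (Or.inl hz)
  have ha6 : |z.arg| ≤ Real.pi / 6 := by
    by_contra hcon
    push Not at hcon
    have h1 : Real.cos |z.arg| < Real.cos (Real.pi / 6) :=
      Real.cos_lt_cos_of_nonneg_of_le_pi (by positivity) (by linarith [Real.pi_pos]) hcon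
    rw [Real.cos_abs, Real.cos_pi_div_six] at h1
    have hzp : 0 < ‖z‖ := norm_pos_iff.mpr hz0
    have hr : z.re = ‖z‖ * Real.cos z.arg := (Complex.norm_mul_cos_arg z).symm
    have hn2 : ‖z‖ ^ 2 = z.re ^ 2 + z.im ^ 2 := by
      rw [Complex.sq_norm, Complex.normSq_apply]; ring
    have hc : 0 < Real.cos z.arg := by
      by_contra h; push Not at h; nlinarith
    have h33 : Real.sqrt 3 ^ 2 = 3 := Real.sq_sqrt (by norm_num)
    have h4 : Real.cos z.arg ^ 2 < 3 / 4 := by nlinarith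
    have h5 : z.re ^ 2 = ‖z‖ ^ 2 * Real.cos z.arg ^ 2 := by rw [hr]; rw [mul_pow]
    nlinarith [pow_pos hzp 2]
  rw [him, hno, abs_mul, abs_of_pos hR]
  gcongr
  calc |Real.sin (z.arg / n)| ≤ |z.arg / n| := Real.abs_sin_le_abs
    _ ≤ _ := by
      rw [abs_div, abs_of_pos (by linarith : (0 : ℝ) < n), div_le_iff₀ (by linarith)]
      nlinarith [Real.pi_pos]

lemma consts (n : ℕ) (hn : 3 ≤ n) : ∃ μ b : ℝ, 1 < μ ∧ 0 < b ∧ μ ^ n = 2 ∧ b ^ n = 2 * b ∧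
    b ^ 2 ≤ 2 ∧ b ≤ 2 * μ - 1 ∧ 1 + 0.635 ^ n ≤ μ := by
  have hn' : (3 : ℝ) ≤ n := by exact_mod_cast hn
  have hμ : ((2 : ℝ) ^ (1 / (n : ℝ))) ^ n = 2 := by
    rw [one_div]; exact Real.rpow_inv_natCast_pow (by norm_num) (by omega)
  have hb : ((2 : ℝ) ^ (1 / ((n - 1 : ℕ) : ℝ))) ^ (n - 1) = 2 := by
    rw [one_div]; exact Real.rpow_inv_natCast_pow (by norm_num) (by omega)
  set μ := (2 : ℝ) ^ (1 / (n : ℝ)) with hμd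
  set b := (2 : ℝ) ^ (1 / ((n - 1 : ℕ) : ℝ)) with hbd
  have hbp : 0 < b := by positivity
  have hμp : 0 < μ := by positivity
  have hμ1 : 1 < μ := by
    by_contra h
    push Not at h
    have := pow_le_one₀ hμp.le h (n := n)
    linarith
  have hμ2 : μ ≤ 2 := by
    by_contra h
    push Not at h
    have : (μ : ℝ) ^ 1 ≤ μ ^ n := pow_le_pow_right₀ hμ1.le (by omega)
    linarith
  have hb1 : 1 ≤ b := by
    by_contra h
    push Not at h
    have := pow_le_one₀ hbp.le h.le (n := n - 1)
    linarith
  refine ⟨μ, b, hμ1, hbp, hμ, ?_, ?_, ?_, ?_⟩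
  · have : n = (n - 1) + 1 := by omega
    rw [this, pow_succ, hb]
  · calc b ^ 2 ≤ b ^ (n - 1) := pow_le_pow_right₀ hb1 (by omega)
      _ = 2 := hb
  · by_contra h
    push Not at h
    have h1 : (2 * μ - 1) ^ (n - 1) < b ^ (n - 1) :=
      pow_lt_pow_left₀ h (by linarith) (by omega)
    rw [hb] at h1
    have h2 : μ ^ 3 ≤ (2 * μ - 1) ^ 2 := by nlinarith [mul_nonneg (by linarith : 0 ≤ μ - 1) (by nlinarith : 0 ≤ -μ ^ 2 + 3 * μ - 1)]
    have h3 : (μ ^ 3) ^ (n - 1) ≤ ((2 * μ - 1) ^ 2) ^ (n - 1) := by gcongr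
    have h4 : μ ^ (2 * n) ≤ (μ ^ 3) ^ (n - 1) := by
      rw [← pow_mul]; exact pow_le_pow_right₀ hμ1.le (by omega)
    rw [mul_comm 2 n, pow_mul, hμ] at h4
    rw [pow_right_comm (2 * μ - 1)] at h3
    have h5 : 0 ≤ (2 * μ - 1) ^ (n - 1) := by
      have : 0 ≤ 2 * μ - 1 := by linarith
      positivity
    nlinarith
  · have h1 : (1 + 0.635 ^ n : ℝ) ^ n ≤ 2 := by
      rcases Nat.lt_or_ge 3 n with h4 | h4
      · have h5 : ∀ m : ℕ, (m + 4 : ℝ) * 0.635 ^ (m + 4) ≤ 0.66 := by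
          intro m
          induction m with
          | zero => norm_num
          | succ m ih =>
            push_cast
            have : (0 : ℝ) < 0.635 ^ (m + 4) := by positivity
            rw [show m + 1 + 4 = (m + 4) + 1 by ring, pow_succ]
            have hm : (0 : ℝ) ≤ m := by positivity
            nlinarith
        obtain ⟨m, rfl⟩ : ∃ m, n = m + 4 := ⟨n - 4, by omega⟩
        have h6 := h5 m
        calc (1 + 0.635 ^ (m + 4) : ℝ) ^ (m + 4)
            ≤ (Real.exp (0.635 ^ (m + 4))) ^ (m + 4) := by
              gcongr; linarith [Real.add_one_le_exp ((0.635 : ℝ) ^ (m + 4))]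
          _ = Real.exp ((m + 4 : ℝ) * 0.635 ^ (m + 4)) := by
              rw [← Real.exp_nat_mul]; push_cast; rfl
          _ ≤ Real.exp (Real.log 2) := by
              gcongr; linarith [Real.log_two_gt_d9]
          _ = 2 := Real.exp_log (by norm_num)
      · obtain rfl : n = 3 := by omega
        norm_num
    by_contra h
    push Not at h
    have := pow_lt_pow_left₀ h hμp.le (by omega : n ≠ 0)
    linarith

/-- the main estimate -/
lemma dist_lt_one (a p r k b : ℝ) (hb0 : 0 < b) (hb : b ^ 2 ≤ 2) (ha1 : 1 < a) (ha2 : a < b) (hp : |p| < 0.247)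
    (hr : 0.635 < r) (hk : 3 * k ^ 2 < r ^ 2) (hrk : r ^ 2 + k ^ 2 < b ^ 2) :
    (a - r) ^ 2 + (p - k) ^ 2 < 1 := by
  have hb' : b < 1.4143 := by nlinarith
  have ha3 : a < 1.4143 := by linarith
  have hk0 : 0 ≤ |k| := abs_nonneg _
  have hk2 : |k| ^ 2 = k ^ 2 := sq_abs k
  have hpk : (p - k) ^ 2 ≤ (|k| + 0.247) ^ 2 := by
    rw [← sq_abs (p - k)]
    have : |p - k| ≤ |k| + 0.247 := by linarith [abs_sub p k]
    gcongr
  set K := |k|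
  have hK1 : K < 0.5774 * r := by nlinarith
  have hK2 : K < 0.7072 := by nlinarith
  have hr2 : r < 1.4143 := by nlinarith
  suffices (a - r) ^ 2 + (K + 0.247) ^ 2 < 1 by linarith
  rcases le_total a r with h | h
  · have h1 : (a - r) ^ 2 ≤ (r - 1) ^ 2 := by
      rw [show (a - r) ^ 2 = (r - a) ^ 2 by ring]
      apply pow_le_pow_left₀ <;> linarith
    have h2 : K ^ 2 ≤ 2 - r ^ 2 := by linarith
    have e1 : (r - 1) ^ 2 = r ^ 2 - 2 * r + 1 := by ring
    have e2 : (K + 0.247) ^ 2 = K ^ 2 + 0.494 * K + 0.061009 := by ring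
    rcases le_total r 1.2247 with h3 | h3
    · have h4 : (K + 0.247) ^ 2 ≤ (0.5774 * r + 0.247) ^ 2 := by gcongr
      have e3 : (0.5774 * r + 0.247) ^ 2 = 0.5774 ^ 2 * r ^ 2 + 2 * 0.5774 * 0.247 * r + 0.061009 := by
        ring
      have h5 : 0 ≤ (r - 1) * (1.2247 - r) := mul_nonneg (by linarith) (by linarith)
      have h6 : r ^ 2 ≤ 2.2247 * r - 1.2247 := by linarith
      linarith
    · linarith
  · have h1 : (a - r) ^ 2 ≤ (1.4143 - r) ^ 2 := by
      apply pow_le_pow_left₀ <;> linarith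
    rcases le_total r 1.2247 with h3 | h3
    · have h4 : (K + 0.247) ^ 2 ≤ (0.5774 * r + 0.247) ^ 2 := by gcongr
      have e3 : (0.5774 * r + 0.247) ^ 2 = 0.5774 ^ 2 * r ^ 2 + 2 * 0.5774 * 0.247 * r + 0.061009 := by
        ring
      have e4 : (1.4143 - r) ^ 2 = 1.4143 ^ 2 - 2 * 1.4143 * r + r ^ 2 := by ring
      have h5 : 0 ≤ (r - 0.635) * (1.2247 - r) := mul_nonneg (by linarith) (by linarith)
      have h6 : r ^ 2 ≤ 1.8597 * r - 0.635 * 1.2247 := by linarith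
      linarith
    · have h4 : (K + 0.247) ^ 2 ≤ (0.7072 + 0.247) ^ 2 := by gcongr
      have h5 : (1.4143 - r) ^ 2 ≤ 0.1896 ^ 2 := by
        apply pow_le_pow_left₀ <;> linarith
      linarith

/-- Combinatorial and size data of the critical orbit. -/
structure OrbitData (ℓ q : ℕ) (c : ℕ → ℝ) (μ b : ℝ) : Prop where
  h3 : 3 ≤ ℓ
  hodd : Odd ℓ
  hq : 4 ≤ q
  hrec : ∀ i, 1 ≤ i → c (i + 1) = |c i| ^ ℓ + c 1
  hper : c (q + 1) = 0
  hne : ∀ i, 1 ≤ i → i ≤ q → c i ≠ 0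
  hneg : ∀ i, 1 ≤ i → i ≤ q → c i < 0 → 0 ≤ c (i + 1)
  hc1 : c 1 < 0
  hc2 : 0 < c 2
  hc3 : 0 < c 3
  hc4 : 0 < c 4
  hμ1 : 1 < μ
  hb0 : 0 < b
  hμ : μ ^ ℓ = 2
  hb : b ^ ℓ = 2 * b
  hb2 : b ^ 2 ≤ 2
  hbμ : b ≤ 2 * μ - 1
  hsμ : 1 + 0.635 ^ ℓ ≤ μ

/-- sign of `c i` -/
noncomputable def sg (c : ℕ → ℝ) (i : ℕ) : ℂ := if c i < 0 then -1 else 1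

/-- Admissible complex configurations. -/
structure GoodCfg (ℓ q : ℕ) (c : ℕ → ℝ) (μ b : ℝ) (x : ℕ → ℂ) : Prop where
  zero : x (q + 1) = 0
  root : ∀ i, 1 ≤ i → i ≤ q → 0 ≤ c (i + 1) →
    0.635 < (sg c i * x i).re ∧ 3 * (sg c i * x i).im ^ 2 < (sg c i * x i).re ^ 2 ∧
      ‖sg c i * x i‖ < b
  small : ∀ i, 1 ≤ i → i ≤ q → c (i + 1) < 0 → ‖x i‖ < 1
  e1 : μ < (-x 1).re
  e2 : |(x 1).im| < 0.247
  x2 : 1 < (x 2).re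
  inj : ∀ i j, 1 ≤ i → i ≤ q + 1 → 1 ≤ j → j ≤ q + 1 → x i = x j → i = j

/-- The second configuration is a lift of the first one. -/
structure LiftCfg (ℓ q : ℕ) (c : ℕ → ℝ) (x x' : ℕ → ℂ) : Prop where
  zero : x' (q + 1) = 0
  pow : ∀ i, 1 ≤ i → i ≤ q → (sg c i * x' i) ^ ℓ = x (i + 1) - x 1
  root : ∀ i, 1 ≤ i → i ≤ q → 0 ≤ c (i + 1) →
    sg c i * x' i = (x (i + 1) - x 1) ^ (1 / (ℓ : ℂ))

lemma sg_neg {c : ℕ → ℝ} {i : ℕ} (h : c i < 0) : sg c i = -1 := by simp [sg, h]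
lemma sg_pos {c : ℕ → ℝ} {i : ℕ} (h : 0 ≤ c i) : sg c i = 1 := by simp [sg, not_lt.mpr h]
lemma norm_sg (c : ℕ → ℝ) (i : ℕ) : ‖sg c i‖ = 1 := by
  unfold sg; split_ifs <;> simp
lemma sg_ne (c : ℕ → ℝ) (i : ℕ) : sg c i ≠ 0 := by
  unfold sg; split_ifs <;> simp
lemma sg_mul_self (c : ℕ → ℝ) (i : ℕ) : sg c i * sg c i = 1 := by
  unfold sg; split_ifs <;> simp

lemma succ_est {ℓ q : ℕ} {c : ℕ → ℝ} {μ b : ℝ} (H : OrbitData ℓ q c μ b) {x : ℕ → ℂ}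
    (hx : GoodCfg ℓ q c μ b x) (i : ℕ) (hi : 1 ≤ i) (hiq : i ≤ q) (hc : 0 ≤ c (i + 1)) :
    -1 < (x (i + 1)).re ∧ ‖x (i + 1)‖ < b := by
  have hb1 : 1 < b := by
    have h1 := hx.root 1 le_rfl (by linarith [H.hq]) H.hc2.le
    rw [sg_neg H.hc1, neg_one_mul] at h1
    have := Complex.re_le_norm (-x 1)
    linarith [hx.e1, H.hμ1]
  rcases Nat.lt_or_ge i q with h | h
  · rcases lt_or_ge (c (i + 1 + 1)) 0 with h1 | h1
    · have h2 := hx.small (i + 1) (by omega) (by omega) h1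
      have h3 := Complex.abs_re_le_norm (x (i + 1))
      rw [abs_le] at h3
      exact ⟨by linarith, by linarith⟩
    · have h2 := hx.root (i + 1) (by omega) (by omega) h1
      rw [sg_pos hc, one_mul] at h2
      exact ⟨by linarith, h2.2.2⟩
  · obtain rfl : i = q := by omega
    rw [hx.zero]
    simp [H.hb0]

lemma root_est {ℓ q : ℕ} {c : ℕ → ℝ} {μ b : ℝ} (H : OrbitData ℓ q c μ b) {x : ℕ → ℂ}
    (hx : GoodCfg ℓ q c μ b x) (i : ℕ) (hi : 1 ≤ i) (hiq : i ≤ q) (hc : 0 ≤ c (i + 1)) :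
    0 < (x (i + 1) - x 1).re := by
  have h1 := succ_est H hx i hi hiq hc
  have h2 := hx.e1
  have h3 := H.hμ1
  simp at h2 ⊢
  linarith

lemma good_lift {ℓ q : ℕ} {c : ℕ → ℝ} {μ b : ℝ} (H : OrbitData ℓ q c μ b) {x x' : ℕ → ℂ}
    (hx : GoodCfg ℓ q c μ b x) (hl : LiftCfg ℓ q c x x') : GoodCfg ℓ q c μ b x' := by
  have hℓ0 : ℓ ≠ 0 := by have := H.h3; omega
  have hq4 := H.hq
  have hr1 := hx.root 1 le_rfl (by omega) H.hc2.le
  rw [sg_neg H.hc1, neg_one_mul] at hr1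
  have he1 := hx.e1
  have hroot : ∀ i, 1 ≤ i → i ≤ q → 0 ≤ c (i + 1) →
    0.635 < (sg c i * x' i).re ∧ 3 * (sg c i * x' i).im ^ 2 < (sg c i * x' i).re ^ 2 ∧
      ‖sg c i * x' i‖ < b := by
    intro i hi hiq hc
    have h1 := succ_est H hx i hi hiq hc
    have h2 := root_re _ (root_est H hx i hi hiq hc) ℓ H.h3
    rw [← hl.root i hi hiq hc] at h2
    refine ⟨?_, h2.2.2, ?_⟩
    · have h3 : (0.635 : ℝ) ^ ℓ < (sg c i * x' i).re ^ ℓ := by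
        refine lt_of_lt_of_le ?_ h2.2.1
        have := H.hsμ
        simp only [Complex.sub_re, Complex.neg_re] at he1 ⊢
        linarith
      exact lt_of_pow_lt_pow_left₀ ℓ h2.1.le h3
    · have h3 : ‖sg c i * x' i‖ ^ ℓ < b ^ ℓ := by
        rw [← norm_pow, hl.pow i hi hiq, H.hb]
        have := norm_sub_le (x (i + 1)) (x 1)
        rw [norm_neg] at hr1
        linarith
      exact lt_of_pow_lt_pow_left₀ ℓ H.hb0.le h3
  have hdiff : ∀ i j, 1 ≤ i → i ≤ q → 1 ≤ j → j ≤ q → c i < 0 → 0 ≤ c j → x' i ≠ x' j := by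
    intro i j hi hiq hj hjq hci hcj heq
    have hci1 := H.hneg i hi hiq hci
    have hi1 := hroot i hi hiq hci1
    rw [sg_neg hci, neg_one_mul] at hi1
    rcases lt_or_ge (c (j + 1)) 0 with h1 | h1
    · have hj1q : j + 1 ≤ q := by
        by_contra h
        have : j = q := by omega
        subst this
        linarith [H.hper]
      have hp1 := hl.pow i hi hiq
      have hp2 := hl.pow j hj hjq
      rw [sg_neg hci, neg_one_mul, H.hodd.neg_pow] at hp1
      rw [sg_pos hcj, one_mul, ← heq] at hp2
      have hy := hx.root (j + 1) (by omega) hj1q (H.hneg (j + 1) (by omega) hj1q h1)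
      rw [sg_neg h1, neg_one_mul] at hy
      have he : -x (j + 1) = 2 * (-x 1) + x (i + 1) := by
        linear_combination hp1 + hp2
      have h5 := Complex.re_le_norm (-x (j + 1))
      have h6 : (-x (j + 1)).re = 2 * (-x 1).re + (x (i + 1)).re := by
        rw [he]; simp
      have h7 := succ_est H hx i hi hiq hci1
      linarith [H.hbμ]
    · have hj1 := hroot j hj hjq h1
      rw [sg_pos hcj, one_mul, ← heq] at hj1
      simp only [Complex.neg_re] at hi1
      linarith [hi1.1, hj1.1]
  refine ⟨hl.zero, hroot, ?_, ?_, ?_, ?_, ?_⟩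
  · intro i hi hiq hc
    have hi1q : i + 1 ≤ q := by
      by_contra h
      have : i = q := by omega
      subst this
      linarith [H.hper]
    have hy := hx.root (i + 1) (by omega) hi1q (H.hneg (i + 1) (by omega) hi1q hc)
    rw [sg_neg hc, neg_one_mul] at hy
    have hn1 := Complex.re_le_norm (-x 1)
    have key := dist_lt_one (-x 1).re (-x 1).im (-x (i + 1)).re (-x (i + 1)).im b H.hb0 H.hb2
      (by linarith [H.hμ1]) (by linarith) (by simpa using hx.e2) hy.1 hy.2.1 (by
        have h1 : ‖-x (i + 1)‖ ^ 2 < b ^ 2 := by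
          have := norm_nonneg (-x (i + 1))
          have := hy.2.2
          gcongr
        rw [Complex.sq_norm, Complex.normSq_apply] at h1
        linarith)
    have h2 : ‖x (i + 1) - x 1‖ ^ 2 < 1 := by
      rw [Complex.sq_norm, Complex.normSq_apply]
      simp only [Complex.neg_re, Complex.neg_im, Complex.sub_re, Complex.sub_im] at key ⊢
      linarith
    have h3 : ‖x (i + 1) - x 1‖ < 1 := by
      have := norm_nonneg (x (i + 1) - x 1)
      nlinarith
    rw [← hl.pow i hi hiq, norm_pow, norm_mul, norm_sg, one_mul] at h3
    by_contra h
    push Not at h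
    linarith [one_le_pow₀ h (n := ℓ)]
  · have h2 := root_re _ (root_est H hx 1 le_rfl (by omega) H.hc2.le) ℓ H.h3
    rw [← hl.root 1 le_rfl (by omega) H.hc2.le, sg_neg H.hc1, neg_one_mul] at h2
    have h3 : μ ^ ℓ < (-x' 1).re ^ ℓ := by
      refine lt_of_lt_of_le ?_ h2.2.1
      rw [H.hμ]
      have := hx.x2
      have := H.hμ1
      simp only [Complex.sub_re, Complex.neg_re] at he1 ⊢
      norm_num
      linarith
    exact lt_of_pow_lt_pow_left₀ ℓ h2.1.le h3
  · have hr2 := hx.root 2 (by omega) (by omega) H.hc3.le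
    rw [sg_pos H.hc2.le, one_mul] at hr2
    have h2 := root_im _ (root_est H hx 1 le_rfl (by omega) H.hc2.le) (by
      simp only [Complex.sub_re, Complex.sub_im, Complex.neg_re, Complex.neg_im] at hr1 ⊢
      norm_num
      set A := (x 2).re
      set B := (x 2).im
      set D := -(x 1).re
      set E := -(x 1).im
      have e1 : (x 1).re = -D := by simp [D]
      have e2 : (x 1).im = -E := by simp [E]
      rw [e1, e2]
      have h5 : |B * E| * 3 < A * D := by
        have h6 : (|B * E| * 3) ^ 2 < (A * D) ^ 2 := by
          rw [mul_pow, sq_abs]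
          nlinarith [mul_pos (sub_pos.mpr hr2.2.1) (sub_pos.mpr hr1.2.1), sq_nonneg B, sq_nonneg E,
            mul_nonneg (sub_pos.mpr hr2.2.1).le (sq_nonneg E),
            mul_nonneg (sub_pos.mpr hr1.2.1).le (sq_nonneg B)]
        have hA : 0 < A := by linarith
        have hD : 0 < D := by linarith
        exact lt_of_pow_lt_pow_left₀ 2 (by positivity) h6
      have h7 := le_abs_self (B * E)
      nlinarith) ℓ H.h3
    rw [← hl.root 1 le_rfl (by omega) H.hc2.le, sg_neg H.hc1, neg_one_mul] at h2
    have h4 := (hroot 1 le_rfl (by omega) H.hc2.le).2.2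
    rw [sg_neg H.hc1, neg_one_mul] at h4
    simp only [Complex.neg_im, abs_neg] at h2
    have hb' : b < 1.41422 := by nlinarith [H.hb2, H.hb0]
    have := Real.pi_lt_d4
    have := norm_nonneg (-x' 1)
    have := Real.pi_pos
    calc |(x' 1).im| ≤ ‖-x' 1‖ * (Real.pi / 18) := h2
      _ ≤ 1.41422 * (3.1416 / 18) := by gcongr <;> linarith
      _ < 0.247 := by norm_num
  · have h2 := root_re _ (root_est H hx 2 (by omega) (by omega) H.hc3.le) ℓ H.h3
    rw [← hl.root 2 (by omega) (by omega) H.hc3.le, sg_pos H.hc2.le, one_mul] at h2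
    have hr3 := hx.root 3 (by omega) (by omega) H.hc4.le
    rw [sg_pos H.hc3.le, one_mul] at hr3
    by_contra h
    push Not at h
    have h5 := pow_le_one₀ h2.1.le h (n := ℓ)
    have := H.hμ1
    have h6 := h2.2.1
    simp only [Complex.sub_re, Complex.neg_re] at he1 h6
    norm_num at h6
    linarith [hr3.1]
  · have hz : ∀ j, 1 ≤ j → j ≤ q → x' j ≠ 0 := by
      intro j hj hjq h0
      have := hl.pow j hj hjq
      rw [h0, mul_zero, zero_pow hℓ0] at this
      have h1 := hx.inj (j + 1) 1 (by omega) (by omega) le_rfl (by omega)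
        (sub_eq_zero.mp this.symm)
      omega
    intro i j hi hiq hj hjq heq
    rcases Nat.lt_or_ge q i with h1 | h1
    · obtain rfl : i = q + 1 := by omega
      rcases Nat.lt_or_ge q j with h2 | h2
      · omega
      · exact absurd (heq.symm.trans hl.zero) (hz j hj h2)
    rcases Nat.lt_or_ge q j with h2 | h2
    · obtain rfl : j = q + 1 := by omega
      exact absurd (heq.trans hl.zero) (hz i hi h1)
    have same : sg c i = sg c j → i = j := by
      intro hs
      have e1 := hl.pow i hi h1
      have e2 := hl.pow j hj h2
      rw [hs, heq, e2] at e1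
      have := hx.inj (j + 1) (i + 1) (by omega) (by omega) (by omega) (by omega)
        (sub_left_injective e1)
      omega
    rcases lt_or_ge (c i) 0 with h3 | h3 <;> rcases lt_or_ge (c j) 0 with h4 | h4
    · exact same (by rw [sg_neg h3, sg_neg h4])
    · exact absurd heq (hdiff i j hi h1 hj h2 h3 h4)
    · exact absurd heq.symm (hdiff j i hj h2 hi h1 h4 h3)
    · exact same (by rw [sg_pos h3, sg_pos h4])

open Metric in
lemma exists_root (g : ℂ → ℂ) (r : ℝ) (hr : 0 < r) (hg : DifferentiableOn ℂ g (ball 0 r))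
    (hne : ∀ z ∈ ball (0 : ℂ) r, g z ≠ 0) (n : ℕ) (hn : n ≠ 0) (v : ℂ) (hv : v ^ n = g 0) :
    ∃ h : ℂ → ℂ, DifferentiableOn ℂ h (ball 0 r) ∧ h 0 = v ∧ ∀ z ∈ ball (0 : ℂ) r, h z ^ n = g z := by
  have hd : DifferentiableOn ℂ (fun z => deriv g z / g z) (ball 0 r) :=
    (hg.deriv isOpen_ball).div hg hne
  obtain ⟨G, hG0, hG⟩ := hd.isExactOn_ball.with_val_at 0 0
  have hφ : ∀ z ∈ ball (0 : ℂ) r, HasDerivAt (fun z => g z * Complex.exp (-G z)) 0 z := by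
    intro z hz
    have h1 : HasDerivAt g (deriv g z) z :=
      (hg.differentiableAt (isOpen_ball.mem_nhds hz)).hasDerivAt
    have h2 := h1.mul ((hG z hz).neg.cexp)
    have e : g z * (deriv g z / g z) = deriv g z := mul_div_cancel₀ _ (hne z hz)
    refine h2.congr_deriv ?_
    simp only [Pi.neg_apply]
    linear_combination -Complex.exp (-G z) * e
  have hconst : ∀ z ∈ ball (0 : ℂ) r, g z * Complex.exp (-G z) = g 0 := by
    intro z hz
    have := isOpen_ball.is_const_of_deriv_eq_zero (convex_ball (0 : ℂ) r).isPreconnected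
      (f := fun z => g z * Complex.exp (-G z))
      (fun z hz => (hφ z hz).differentiableAt.differentiableWithinAt)
      (fun z hz => (hφ z hz).deriv) hz (mem_ball_self hr)
    simpa [hG0] using this
  refine ⟨fun z => v * Complex.exp (G z / n), ?_, by simp [hG0], ?_⟩
  · intro z hz
    exact (((hG z hz).differentiableAt.div_const _).cexp.const_mul v).differentiableWithinAt
  · intro z hz
    rw [mul_pow, hv, ← hconst z hz, ← Complex.exp_nat_mul, mul_div_cancel₀ _ (by exact_mod_cast hn),
      mul_assoc, ← Complex.exp_add]
    simp

/-- Holomorphic motion of admissible configurations over a disc. -/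
structure Mot (ℓ q : ℕ) (c : ℕ → ℝ) (μ b r : ℝ) (X : ℕ → ℂ → ℂ) : Prop where
  diff : ∀ i, 1 ≤ i → i ≤ q + 1 → DifferentiableOn ℂ (X i) (Metric.ball 0 r)
  good : ∀ z ∈ Metric.ball (0 : ℂ) r, GoodCfg ℓ q c μ b (fun i => X i z)
  base : ∀ i, 1 ≤ i → i ≤ q + 1 → X i 0 = c i

lemma sg_mul_c (c : ℕ → ℝ) (i : ℕ) : sg c i * (c i : ℂ) = ((|c i| : ℝ) : ℂ) := by
  rcases lt_or_ge (c i) 0 with h | h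
  · rw [sg_neg h, abs_of_neg h]; simp
  · rw [sg_pos h, abs_of_nonneg h]; simp

open Metric in
lemma lift_exists {ℓ q : ℕ} {c : ℕ → ℝ} {μ b r : ℝ} (hr : 0 < r) (H : OrbitData ℓ q c μ b)
    {X : ℕ → ℂ → ℂ} (hX : Mot ℓ q c μ b r X) :
    ∃ X' : ℕ → ℂ → ℂ, Mot ℓ q c μ b r X' ∧
      ∀ z ∈ ball (0 : ℂ) r, LiftCfg ℓ q c (fun i => X i z) (fun i => X' i z) := by
  have hℓ0 : ℓ ≠ 0 := by have := H.h3; omega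
  have hq := H.hq
  have key : ∀ i, ∃ Y : ℂ → ℂ, 1 ≤ i → i ≤ q →
      DifferentiableOn ℂ Y (ball 0 r) ∧ Y 0 = c i ∧
      (∀ z ∈ ball (0 : ℂ) r, (sg c i * Y z) ^ ℓ = X (i + 1) z - X 1 z) ∧
      (0 ≤ c (i + 1) → ∀ z ∈ ball (0 : ℂ) r,
        sg c i * Y z = (X (i + 1) z - X 1 z) ^ (1 / (ℓ : ℂ))) := by
    intro i
    by_cases hi : 1 ≤ i ∧ i ≤ q
    swap
    · exact ⟨0, fun h1 h2 => absurd ⟨h1, h2⟩ hi⟩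
    obtain ⟨hi, hiq⟩ := hi
    have hdg : DifferentiableOn ℂ (fun z => X (i + 1) z - X 1 z) (ball 0 r) :=
      (hX.diff (i + 1) (by omega) (by omega)).sub (hX.diff 1 le_rfl (by omega))
    have h00 : X (i + 1) 0 - X 1 0 = ((|c i| : ℝ) : ℂ) ^ ℓ := by
      rw [hX.base _ (by omega) (by omega), hX.base 1 le_rfl (by omega), H.hrec i hi]
      push_cast; ring
    rcases lt_or_ge (c (i + 1)) 0 with hc | hc
    · have hci : 0 ≤ c i := by
        by_contra h
        push Not at h
        linarith [H.hneg i hi hiq h]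
      obtain ⟨Y, h1, h2, h3⟩ := exists_root (fun z => X (i + 1) z - X 1 z) r hr hdg (by
          intro z hz h0
          have := (hX.good z hz).inj (i + 1) 1 (by omega) (by omega) le_rfl (by omega)
            (sub_eq_zero.mp h0)
          omega) ℓ hℓ0 (c i) (by
            show _ = X (i + 1) 0 - X 1 0
            rw [h00, abs_of_nonneg hci])
      refine ⟨Y, fun _ _ => ⟨h1, h2, ?_, fun h => absurd h (not_le.mpr hc)⟩⟩
      intro z hz
      rw [sg_pos hci, one_mul]
      exact h3 z hz
    · have hs : ∀ w : ℂ, sg c i * (sg c i * w) = w := by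
        intro w; rw [← mul_assoc, sg_mul_self, one_mul]
      refine ⟨fun z => sg c i * (X (i + 1) z - X 1 z) ^ (1 / (ℓ : ℂ)), fun _ _ => ⟨?_, ?_, ?_, ?_⟩⟩
      · refine DifferentiableOn.const_mul ?_ _
        refine hdg.cpow_const ?_
        intro z hz
        exact Or.inl (root_est H (hX.good z hz) i hi hiq hc)
      · show sg c i * (X (i + 1) 0 - X 1 0) ^ (1 / (ℓ : ℂ)) = c i
        rw [h00, one_div]
        have : (((|c i| : ℝ) : ℂ) ^ ℓ) ^ ((ℓ : ℂ)⁻¹) = ((|c i| : ℝ) : ℂ) := by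
          rw [← Complex.ofReal_pow, show ((ℓ : ℂ)⁻¹) = (((ℓ : ℝ)⁻¹ : ℝ) : ℂ) by push_cast; rfl,
            ← Complex.ofReal_cpow (by positivity), Real.pow_rpow_inv_natCast (abs_nonneg _) hℓ0]
        rw [this, ← sg_mul_c, hs]
      · intro z hz
        show (sg c i * (sg c i * _)) ^ ℓ = _
        rw [hs, cpow_root_pow _ _ hℓ0]
      · intro _ z hz
        show (sg c i * (sg c i * _)) = _
        rw [hs]
  choose Y hY using key
  have hlift : ∀ z ∈ ball (0 : ℂ) r, LiftCfg ℓ q c (fun i => X i z)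
      (fun i => (if i ≤ q then Y i else 0) z) := by
    intro z hz
    refine ⟨by simp, ?_, ?_⟩
    · intro i hi hiq
      simp only [hiq, if_true]
      exact (hY i hi hiq).2.2.1 z hz
    · intro i hi hiq hc
      simp only [hiq, if_true]
      exact (hY i hi hiq).2.2.2 hc z hz
  refine ⟨fun i => if i ≤ q then Y i else 0, ⟨?_, fun z hz => good_lift H (hX.good z hz) (hlift z hz),
    ?_⟩, hlift⟩
  · intro i hi hiq
    by_cases h : i ≤ q
    · simp only [h, if_true]
      exact (hY i hi h).1
    · simp only [h, if_false]
      exact differentiableOn_const (c := (0 : ℂ))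
  · intro i hi hiq
    by_cases h : i ≤ q
    · simp only [h, if_true]
      exact (hY i hi h).2.1
    · obtain rfl : i = q + 1 := by omega
      simp [H.hper]

open Filter Topology in
lemma pow_limit {l : Filter ℂ} {A B p : ℂ → ℂ} {a u : ℂ} (n : ℕ) (hn : n ≠ 0) (ha : a ≠ 0)
    (hA : Tendsto A l (𝓝 a)) (hB : Tendsto B l (𝓝 a))
    (hu : Tendsto (fun z => (A z ^ n - B z ^ n) / p z) l (𝓝 u)) :
    Tendsto (fun z => (A z - B z) / p z) l (𝓝 (u / (n * a ^ (n - 1)))) := by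
  have hS : Tendsto (fun z => ∑ k ∈ Finset.range n, A z ^ k * B z ^ (n - 1 - k)) l
      (𝓝 (n * a ^ (n - 1))) := by
    have h1 : Tendsto (fun z => ∑ k ∈ Finset.range n, A z ^ k * B z ^ (n - 1 - k)) l
      (𝓝 (∑ k ∈ Finset.range n, a ^ k * a ^ (n - 1 - k))) :=
      tendsto_finsetSum _ fun k _ => (hA.pow k).mul (hB.pow _)
    convert h1 using 2
    rw [Finset.sum_congr rfl (g := fun _ => a ^ (n - 1))]
    · simp
    · intro k hk
      rw [← pow_add]
      congr 1
      have := Finset.mem_range.mp hk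
      omega
  have h0 : (n : ℂ) * a ^ (n - 1) ≠ 0 := mul_ne_zero (by exact_mod_cast hn) (pow_ne_zero _ ha)
  refine (hu.div hS h0).congr' ?_
  filter_upwards [hS.eventually_ne h0] with z hz
  simp only [Pi.div_apply]
  rw [← geom_sum₂_mul, div_right_comm, mul_div_cancel_left₀ _ hz]

open Filter Topology Metric in
lemma coeff_bound {F : ℂ → ℂ} {r B : ℝ} {u : ℂ} {M : ℕ} (hr : 0 < r) 
    (hF : DifferentiableOn ℂ F (ball 0 r)) (hB : ∀ z ∈ ball (0 : ℂ) r, ‖F z‖ ≤ B)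
    (hu : Tendsto (fun z => F z / z ^ M) (𝓝[≠] 0) (𝓝 u)) : ‖u‖ ≤ B / (r / 2) ^ M := by
  set G := Function.update (fun z => F z / z ^ M) 0 u with hG
  have hGc : ContinuousAt G 0 := continuousAt_update_same.mpr hu
  have hGne : ∀ z, z ≠ 0 → G z = F z / z ^ M := fun z hz => by simp [hG, hz]
  have hGd : DifferentiableOn ℂ G (ball 0 r) := by
    rw [← Complex.differentiableOn_compl_singleton_and_continuousAt_iff (ball_mem_nhds 0 hr)]
    refine ⟨?_, hGc⟩
    have : DifferentiableOn ℂ (fun z => F z / z ^ M) (ball 0 r \ {0}) :=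
      (hF.mono Set.sdiff_subset).div (by fun_prop) (fun z hz => pow_ne_zero _ hz.2)
    exact this.congr fun z hz => hGne z hz.2
  have hr2 : r / 2 ≠ 0 := by positivity
  have := Complex.norm_le_of_forall_mem_frontier_norm_le (f := G) (U := ball 0 (r / 2))
    (C := B / (r / 2) ^ M) isBounded_ball
    (DifferentiableOn.diffContOnCl (by
      rw [closure_ball _ hr2]
      exact hGd.mono (closedBall_subset_ball (by linarith)))) (by
      rw [frontier_ball _ hr2]
      intro z hz
      rw [mem_sphere_zero_iff_norm] at hz
      have hz0 : z ≠ 0 := by rintro rfl; simp at hz; linarith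
      rw [hGne z hz0, norm_div, norm_pow, hz]
      gcongr
      exact hB z (by simp [hz]; linarith)) (z := 0) (subset_closure (mem_ball_self (by linarith)))
  simpa [hG] using this

/-- The base motion, as polynomials in the parameter; `basePoly n` is the motion of `c (n + 1)`. -/
noncomputable def basePoly (ℓ : ℕ) (c : ℕ → ℝ) : ℕ → Polynomial ℂ
  | 0 => Polynomial.X + Polynomial.C (c 1 : ℂ)
  | n + 1 => (Polynomial.C (sg c (n + 1)) * basePoly ℓ c n) ^ ℓ +
      (Polynomial.X + Polynomial.C (c 1 : ℂ))

lemma basePoly_natDegree (ℓ : ℕ) (hℓ : 2 ≤ ℓ) (c : ℕ → ℝ) (n : ℕ) :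
    (basePoly ℓ c n).natDegree = ℓ ^ n := by
  induction n with
  | zero => simp [basePoly]
  | succ n ih =>
    have h1 : ((Polynomial.C (sg c (n + 1)) * basePoly ℓ c n) ^ ℓ).natDegree = ℓ ^ (n + 1) := by
      rw [Polynomial.natDegree_pow, Polynomial.natDegree_C_mul (sg_ne c _), ih]
      ring
    rw [basePoly, Polynomial.natDegree_add_eq_left_of_natDegree_lt, h1]
    rw [h1, Polynomial.natDegree_X_add_C]
    exact Nat.one_lt_pow (by omega) (by omega)

lemma basePoly_ne (ℓ : ℕ) (hℓ : 2 ≤ ℓ) (c : ℕ → ℝ) (n : ℕ) : basePoly ℓ c n ≠ 0 := by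
  intro h
  have := basePoly_natDegree ℓ hℓ c n
  rw [h, Polynomial.natDegree_zero] at this
  have h2 : 0 < ℓ ^ n := by positivity
  omega

/-- The base motion. -/
noncomputable def bm (ℓ : ℕ) (c : ℕ → ℝ) (i : ℕ) (z : ℂ) : ℂ := (basePoly ℓ c (i - 1)).eval z

lemma bm_succ (ℓ : ℕ) (c : ℕ → ℝ) (i : ℕ) (hi : 1 ≤ i) (z : ℂ) :
    (sg c i * bm ℓ c i z) ^ ℓ = bm ℓ c (i + 1) z - bm ℓ c 1 z := by
  obtain ⟨n, rfl⟩ : ∃ n, i = n + 1 := ⟨i - 1, by omega⟩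
  simp [bm, basePoly]

lemma bm_diff (ℓ : ℕ) (c : ℕ → ℝ) (i : ℕ) : Differentiable ℂ (bm ℓ c i) :=
  (basePoly ℓ c (i - 1)).differentiable

lemma bm_zero {ℓ : ℕ} {c : ℕ → ℝ} (hrec : ∀ i, 1 ≤ i → c (i + 1) = |c i| ^ ℓ + c 1)
    (i : ℕ) (hi : 1 ≤ i) : bm ℓ c i 0 = c i := by
  induction i, hi using Nat.le_induction with
  | base => simp [bm, basePoly]
  | succ i hi ih =>
    have h := bm_succ ℓ c i hi 0
    have h1 : bm ℓ c 1 0 = c 1 := by simp [bm, basePoly]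
    rw [ih, sg_mul_c, h1] at h
    rw [hrec i hi]
    push_cast
    rw [h]; ring

lemma bm_order {ℓ q : ℕ} {c : ℕ → ℝ} (hℓ : 2 ≤ ℓ) :
    ∃ (M : ℕ) (R : Polynomial ℂ), R.eval 0 ≠ 0 ∧ ∀ z, bm ℓ c (q + 1) z = z ^ M * R.eval z := by
  obtain ⟨R, h1, h2⟩ := Polynomial.exists_eq_pow_rootMultiplicity_mul_and_not_dvd
    (basePoly ℓ c q) (basePoly_ne ℓ hℓ c q) 0
  refine ⟨(basePoly ℓ c q).rootMultiplicity 0, R, ?_, ?_⟩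
  · intro h
    exact h2 (Polynomial.dvd_iff_isRoot.mpr h)
  · intro z
    show (basePoly ℓ c q).eval z = _
    conv_lhs => rw [h1]
    simp

open Filter Topology in
lemma good_near {ℓ q : ℕ} {c : ℕ → ℝ} {μ b : ℝ} {X : ℕ → ℂ → ℂ}
    (hX : ∀ i, ContinuousAt (X i) 0) (hz : ∀ z, X (q + 1) z = 0)
    (h0 : GoodCfg ℓ q c μ b (fun i => X i 0)) :
    ∀ᶠ z in 𝓝 (0 : ℂ), GoodCfg ℓ q c μ b (fun i => X i z) := by
  have hre : ∀ i, ContinuousAt (fun z => (sg c i * X i z).re) 0 := fun i =>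
    Complex.continuous_re.continuousAt.comp (continuousAt_const.mul (hX i))
  have him : ∀ i, ContinuousAt (fun z => (sg c i * X i z).im) 0 := fun i =>
    Complex.continuous_im.continuousAt.comp (continuousAt_const.mul (hX i))
  have hno : ∀ i, ContinuousAt (fun z => ‖sg c i * X i z‖) 0 := fun i =>
    (continuousAt_const.mul (hX i)).norm
  have e1 : ∀ᶠ z in 𝓝 (0 : ℂ), ∀ i ∈ Finset.Icc 1 q, 0 ≤ c (i + 1) →
    0.635 < (sg c i * X i z).re ∧ 3 * (sg c i * X i z).im ^ 2 < (sg c i * X i z).re ^ 2 ∧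
      ‖sg c i * X i z‖ < b := by
    rw [Filter.eventually_all_finset]
    intro i hi
    rw [Finset.mem_Icc] at hi
    by_cases hc : 0 ≤ c (i + 1)
    · have h := h0.root i hi.1 hi.2 hc
      filter_upwards [continuousAt_const.eventually_lt (hre i) h.1,
        (continuousAt_const.mul ((him i).pow 2)).eventually_lt ((hre i).pow 2) h.2.1,
        (hno i).eventually_lt continuousAt_const h.2.2] with z a1 a2 a3 _
      exact ⟨a1, a2, a3⟩
    · exact Eventually.of_forall fun z h => absurd h hc
  have e2 : ∀ᶠ z in 𝓝 (0 : ℂ), ∀ i ∈ Finset.Icc 1 q, c (i + 1) < 0 → ‖X i z‖ < 1 := by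
    rw [Filter.eventually_all_finset]
    intro i hi
    rw [Finset.mem_Icc] at hi
    by_cases hc : c (i + 1) < 0
    · filter_upwards [(hX i).norm.eventually_lt continuousAt_const (h0.small i hi.1 hi.2 hc)]
        with z a1 _ using a1
    · exact Eventually.of_forall fun z h => absurd h hc
  have e3 : ∀ᶠ z in 𝓝 (0 : ℂ), ∀ i ∈ Finset.Icc 1 (q + 1), ∀ j ∈ Finset.Icc 1 (q + 1),
      X i z = X j z → i = j := by
    rw [Filter.eventually_all_finset]
    intro i hi
    rw [Filter.eventually_all_finset]
    intro j hj
    rw [Finset.mem_Icc] at hi hj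
    by_cases hij : i = j
    · exact Eventually.of_forall fun z _ => hij
    · have hne : X i 0 - X j 0 ≠ 0 := fun h =>
        hij (h0.inj i j hi.1 hi.2 hj.1 hj.2 (sub_eq_zero.mp h))
      filter_upwards [((hX i).sub (hX j)).eventually_ne hne] with z hz h
      exact absurd (sub_eq_zero.mpr h) hz
  filter_upwards [e1, e2, e3,
    continuousAt_const.eventually_lt (Complex.continuous_re.continuousAt.comp (hX 1).neg) h0.e1,
    (Complex.continuous_im.continuousAt.comp (hX 1)).abs.eventually_lt continuousAt_const h0.e2,
    continuousAt_const.eventually_lt (Complex.continuous_re.continuousAt.comp (hX 2)) h0.x2]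
    with z a1 a2 a3 a4 a5 a6
  exact ⟨hz z, fun i hi hq => a1 i (Finset.mem_Icc.mpr ⟨hi, hq⟩),
    fun i hi hq => a2 i (Finset.mem_Icc.mpr ⟨hi, hq⟩), a4, a5, a6,
    fun i j hi hiq hj hjq => a3 i (Finset.mem_Icc.mpr ⟨hi, hiq⟩) j (Finset.mem_Icc.mpr ⟨hj, hjq⟩)⟩

/-- derivative of the real map along the orbit -/
noncomputable def fd (ℓ : ℕ) (c : ℕ → ℝ) (i : ℕ) : ℂ := sg c i * (ℓ * ((|c i| : ℝ) : ℂ) ^ (ℓ - 1))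

/-- The coefficients of the successive lifts. -/
noncomputable def coefU (ℓ q : ℕ) (c : ℕ → ℝ) (a : ℂ) : ℕ → ℕ → ℂ
  | 0, i => if i = q + 1 then -a else 0
  | n + 1, i => if i = q + 1 then -a else (coefU ℓ q c a n (i + 1) - coefU ℓ q c a n 1) / fd ℓ c i

open Filter Topology Metric in
lemma lift_limit {ℓ q : ℕ} {c : ℕ → ℝ} {μ b r : ℝ} (hr : 0 < r) (H : OrbitData ℓ q c μ b)
    {X X' : ℕ → ℂ → ℂ} (hX' : Mot ℓ q c μ b r X')
    (hl : ∀ z ∈ ball (0 : ℂ) r, LiftCfg ℓ q c (fun i => X i z) (fun i => X' i z))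
    {M : ℕ} {u v : ℂ} (i : ℕ) (hi : 1 ≤ i) (hiq : i ≤ q)
    (hu : Tendsto (fun z => (X (i + 1) z - bm ℓ c (i + 1) z) / z ^ M) (𝓝[≠] 0) (𝓝 u))
    (hv : Tendsto (fun z => (X 1 z - bm ℓ c 1 z) / z ^ M) (𝓝[≠] 0) (𝓝 v)) :
    Tendsto (fun z => (X' i z - bm ℓ c i z) / z ^ M) (𝓝[≠] 0) (𝓝 ((u - v) / fd ℓ c i)) := by
  have hℓ0 : ℓ ≠ 0 := by have := H.h3; omega
  have hb : ball (0 : ℂ) r ∈ 𝓝[≠] (0 : ℂ) := mem_nhdsWithin_of_mem_nhds (ball_mem_nhds 0 hr)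
  have hX0 : Tendsto (fun z => sg c i * X' i z) (𝓝[≠] 0) (𝓝 ((|c i| : ℝ) : ℂ)) := by
    have h1 : ContinuousAt (X' i) 0 :=
      ((hX'.diff i hi (by omega)).differentiableAt (ball_mem_nhds 0 hr)).continuousAt
    have h2 := (h1.tendsto.mono_left (nhdsWithin_le_nhds (s := {0}ᶜ))).const_mul (sg c i)
    rwa [hX'.base i hi (by omega), sg_mul_c] at h2
  have hZ0 : Tendsto (fun z => sg c i * bm ℓ c i z) (𝓝[≠] 0) (𝓝 ((|c i| : ℝ) : ℂ)) := by
    have h1 : ContinuousAt (bm ℓ c i) 0 := (bm_diff ℓ c i).continuous.continuousAt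
    have h2 := (h1.tendsto.mono_left (nhdsWithin_le_nhds (s := {0}ᶜ))).const_mul (sg c i)
    rwa [bm_zero H.hrec i hi, sg_mul_c] at h2
  have hc0 : ((|c i| : ℝ) : ℂ) ≠ 0 := by
    exact_mod_cast abs_ne_zero.mpr (H.hne i hi hiq)
  have h3 := pow_limit (p := fun z => z ^ M) (u := u - v) ℓ hℓ0 hc0 hX0 hZ0 (by
    refine (hu.sub hv).congr' ?_
    filter_upwards [hb] with z hz
    have e1 := (hl z hz).pow i hi hiq
    beta_reduce at e1 ⊢
    rw [e1, bm_succ ℓ c i hi]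
    ring)
  have h4 := h3.const_mul (sg c i)
  have e : sg c i * ((u - v) / (ℓ * ((|c i| : ℝ) : ℂ) ^ (ℓ - 1))) = (u - v) / fd ℓ c i := by
    have hs := sg_ne c i
    have hs2 := sg_mul_self c i
    have hs3 : (sg c i)⁻¹ = sg c i := inv_eq_of_mul_eq_one_left hs2
    rw [fd, div_eq_mul_inv (u - v) (sg c i * _), mul_inv, hs3]
    ring
  rw [e] at h4
  refine h4.congr' (Eventually.of_forall fun z => ?_)
  have hs2 := sg_mul_self c i
  linear_combination ((X' i z - bm ℓ c i z) / z ^ M) * hs2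

open Filter Topology Metric in
lemma coef_bounded {ℓ q : ℕ} {c : ℕ → ℝ} {μ b : ℝ} (H : OrbitData ℓ q c μ b)
    (hgc : GoodCfg ℓ q c μ b (fun i => (c i : ℂ))) :
    ∃ a : ℂ, a ≠ 0 ∧ ∃ K : ℝ, ∀ n i, 1 ≤ i → i ≤ q → ‖coefU ℓ q c a n i‖ ≤ K := by
  have hq4 := H.hq
  obtain ⟨M, R, hR0, hR⟩ := bm_order (ℓ := ℓ) (q := q) (c := c) (by have := H.h3; omega)
  refine ⟨R.eval 0, hR0, ?_⟩
  set X0 : ℕ → ℂ → ℂ := fun i => if i = q + 1 then 0 else bm ℓ c i with hX0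
  have hX0c : ∀ i, Differentiable ℂ (X0 i) := by
    intro i
    simp only [hX0]
    split_ifs
    · exact differentiable_const (c := (0 : ℂ))
    · exact bm_diff ℓ c i
  have hX00 : ∀ i, 1 ≤ i → X0 i 0 = c i := by
    intro i hi
    simp only [hX0]
    split_ifs with h
    · rw [h, H.hper]; simp
    · exact bm_zero H.hrec i hi
  have hlast : ∀ z, X0 (q + 1) z = 0 := by intro z; simp [hX0]
  have hg0 : GoodCfg ℓ q c μ b (fun i => X0 i 0) := by
    refine ⟨hlast 0, ?_, ?_, ?_, ?_, ?_, ?_⟩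
    · intro i hi hiq
      simp only [hX00 i hi]
      exact hgc.root i hi hiq
    · intro i hi hiq
      simp only [hX00 i hi]
      exact hgc.small i hi hiq
    · simp only [hX00 1 le_rfl]; exact hgc.e1
    · simp only [hX00 1 le_rfl]; exact hgc.e2
    · simp only [hX00 2 (by omega)]; exact hgc.x2
    · intro i j hi hiq hj hjq
      simp only [hX00 i hi, hX00 j hj]
      exact hgc.inj i j hi hiq hj hjq
  have hev := good_near (fun i => (hX0c i).continuous.continuousAt) hlast hg0
  obtain ⟨r, hr, hball⟩ := Metric.eventually_nhds_iff_ball.mp hev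
  have hM0 : Mot ℓ q c μ b r X0 := ⟨fun i _ _ => (hX0c i).differentiableOn, hball,
    fun i hi _ => hX00 i hi⟩
  have hlastlim : ∀ X, Mot ℓ q c μ b r X →
      Tendsto (fun z => (X (q + 1) z - bm ℓ c (q + 1) z) / z ^ M) (𝓝[≠] 0) (𝓝 (-R.eval 0)) := by
    intro X hX
    have h1 : Tendsto (fun z => -R.eval z) (𝓝[≠] 0) (𝓝 (-R.eval 0)) :=
      (R.continuous.neg.tendsto 0).mono_left nhdsWithin_le_nhds
    refine h1.congr' ?_
    filter_upwards [mem_nhdsWithin_of_mem_nhds (ball_mem_nhds (0 : ℂ) hr),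
      self_mem_nhdsWithin] with z hz hz0
    have h2 : X (q + 1) z = 0 := (hX.good z hz).zero
    have h3 : z ^ M ≠ 0 := pow_ne_zero _ hz0
    rw [h2, hR]
    field_simp
    ring
  have hex : ∀ n, ∃ X, Mot ℓ q c μ b r X ∧ ∀ i, 1 ≤ i → i ≤ q + 1 →
      Tendsto (fun z => (X i z - bm ℓ c i z) / z ^ M) (𝓝[≠] 0)
        (𝓝 (coefU ℓ q c (R.eval 0) n i)) := by
    intro n
    induction n with
    | zero =>
      refine ⟨X0, hM0, fun i hi hiq => ?_⟩
      by_cases h : i = q + 1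
      · subst h
        simpa [coefU] using hlastlim X0 hM0
      · simp [coefU, h, hX0]
    | succ n ih =>
      obtain ⟨X, hX, hlim⟩ := ih
      obtain ⟨X', hX', hl⟩ := lift_exists hr H hX
      refine ⟨X', hX', fun i hi hiq => ?_⟩
      by_cases h : i = q + 1
      · subst h
        simpa [coefU] using hlastlim X' hX'
      · simp only [coefU, h, if_false]
        exact lift_limit hr H hX' hl i hi (by omega) (hlim (i + 1) (by omega) (by omega))
          (hlim 1 le_rfl (by omega))
  -- uniform bounds for the base motion
  have hBi : ∀ i, ∃ B : ℝ, ∀ z ∈ ball (0 : ℂ) r, ‖bm ℓ c i z‖ ≤ B := by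
    intro i
    obtain ⟨B, hB⟩ := (isCompact_closedBall (0 : ℂ) r).exists_bound_of_continuousOn
      (bm_diff ℓ c i).continuous.continuousOn
    exact ⟨B, fun z hz => hB z (ball_subset_closedBall hz)⟩
  choose B hB using hBi
  have hBnn : ∀ i, 0 ≤ B i := fun i => (norm_nonneg _).trans (hB i 0 (mem_ball_self hr))
  refine ⟨(2 + ∑ i ∈ Finset.range (q + 1), B i) / (r / 2) ^ M, fun n i hi hiq => ?_⟩
  obtain ⟨X, hX, hlim⟩ := hex n
  refine coeff_bound hr ((hX.diff i hi (by omega)).sub (bm_diff ℓ c i).differentiableOn) ?_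
    (hlim i hi (by omega))
  intro z hz
  have h1 : ‖X i z‖ ≤ 2 := by
    rcases lt_or_ge (c (i + 1)) 0 with h | h
    · have h2 : ‖X i z‖ < 1 := (hX.good z hz).small i hi hiq h
      linarith
    · have h2 : ‖sg c i * X i z‖ < b := ((hX.good z hz).root i hi hiq h).2.2
      rw [norm_mul, norm_sg, one_mul] at h2
      nlinarith [H.hb2, H.hb0]
  have h2 : B i ≤ ∑ i ∈ Finset.range (q + 1), B i :=
    Finset.single_le_sum (fun i _ => hBnn i) (Finset.mem_range.mpr (by omega))
  have h3 := norm_sub_le (X i z) (bm ℓ c i z)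
  have h4 := hB i z hz
  show ‖X i z - bm ℓ c i z‖ ≤ _
  linarith

lemma core {ℓ q : ℕ} {c : ℕ → ℝ} {μ b : ℝ} (H : OrbitData ℓ q c μ b)
    (hgc : GoodCfg ℓ q c μ b (fun i => (c i : ℂ))) (d : ℕ → ℝ)
    (hd : ∀ i, 1 ≤ i → i ≤ q → (d i : ℂ) = fd ℓ c i) :
    0 < ∑ n ∈ Finset.range (q + 1), 1 / ∏ k ∈ Finset.range n, d (k + 1) := by
  by_contra hS
  push Not at hS
  obtain ⟨a, ha, K, hK⟩ := coef_bounded H hgc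
  have hd0 : ∀ i, 1 ≤ i → i ≤ q → d i ≠ 0 := by
    intro i hi hiq h0
    have h1 := hd i hi hiq
    rw [h0, fd] at h1
    have h2 : ((|c i| : ℝ) : ℂ) ≠ 0 := by exact_mod_cast abs_ne_zero.mpr (H.hne i hi hiq)
    have h3 : (ℓ : ℂ) ≠ 0 := by
      have := H.h3
      exact_mod_cast (by omega : ℓ ≠ 0)
    exact mul_ne_zero (sg_ne c i) (mul_ne_zero h3 (pow_ne_zero _ h2)) (by simpa using h1.symm)
  set e : ℕ → ℝ := fun n => 1 / ∏ k ∈ Finset.range n, d (k + 1) with he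
  have he0 : e 0 = 1 := by simp [he]
  have heS : ∀ n, e (n + 1) = e n / d (n + 1) := by
    intro n
    simp only [he]
    rw [Finset.prod_range_succ, div_mul_eq_div_div]
  have hene : ∀ n, n ≤ q → e n ≠ 0 := by
    intro n hn
    simp only [he]
    refine one_div_ne_zero (Finset.prod_ne_zero_iff.mpr ?_)
    intro k hk
    have := Finset.mem_range.mp hk
    exact hd0 _ (by omega) (by omega)
  set D : ℝ → ℝ := fun ρ => ∑ n ∈ Finset.range (q + 1), ρ ^ n * e n with hD
  have hD0 : D 0 = 1 := by
    simp only [hD]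
    rw [Finset.sum_range_succ']
    simp [he0]
  have hD1 : D 1 ≤ 0 := by simpa [hD] using hS
  have hDc : ContinuousOn D (Set.Icc 0 1) := by
    simp only [hD]
    fun_prop
  obtain ⟨ρ, ⟨hρ0, hρ1⟩, hρ⟩ := intermediate_value_Icc' zero_le_one hDc
    (show (0 : ℝ) ∈ Set.Icc (D 1) (D 0) from ⟨hD1, by rw [hD0]; exact zero_le_one⟩)
  have hρpos : 0 < ρ := by
    rcases hρ0.lt_or_eq with h | h
    · exact h
    · rw [← h, hD0] at hρ
      norm_num at hρ
  set ξ : ℕ → ℂ := fun n => ((ρ ^ n * e n : ℝ) : ℂ) with hξ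
  have hξsum : ∑ n ∈ Finset.range (q + 1), ξ n = 0 := by
    simp only [hξ]
    rw [← Complex.ofReal_sum]
    exact_mod_cast hρ
  have hξq : ξ q ≠ 0 := by
    simp only [hξ]
    exact_mod_cast mul_ne_zero (pow_ne_zero _ hρpos.ne') (hene q le_rfl)
  set V : ℕ → ℕ → ℂ := fun n j => coefU ℓ q c a n (j + 1) with hV
  have hVq : ∀ n, V n q = -a := by
    intro n
    cases n <;> simp [hV, coefU]
  have hVS : ∀ n j, j < q → V (n + 1) j = (V n (j + 1) - V n 0) / (d (j + 1) : ℂ) := by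
    intro n j hj
    rw [hd (j + 1) (by omega) (by omega)]
    have : ¬ (j + 1 = q + 1) := by omega
    simp only [hV, coefU, this, if_false]
  set Φ : ℕ → ℂ := fun n => ∑ j ∈ Finset.range q, ξ j * V n j with hΦ
  have hΦ0 : Φ 0 = 0 := by
    simp only [hΦ]
    refine Finset.sum_eq_zero fun j hj => ?_
    have := Finset.mem_range.mp hj
    have h1 : ¬ (j + 1 = q + 1) := by omega
    simp only [hV, coefU, h1, if_false, mul_zero]
  have hΦS : ∀ n, (ρ : ℂ) * Φ (n + 1) = Φ n - ξ q * a := by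
    intro n
    have h1 : (ρ : ℂ) * Φ (n + 1) =
        ∑ j ∈ Finset.range q, (ξ (j + 1) * V n (j + 1) - V n 0 * ξ (j + 1)) := by
      simp only [hΦ]
      rw [Finset.mul_sum]
      refine Finset.sum_congr rfl fun j hj => ?_
      have hj := Finset.mem_range.mp hj
      rw [hVS n j hj]
      have h2 : ξ (j + 1) = ρ * ξ j / (d (j + 1) : ℂ) := by
        simp only [hξ]
        rw [heS]
        push_cast
        ring
      rw [h2]
      ring
    rw [Finset.sum_sub_distrib, ← Finset.mul_sum] at h1
    have h2 := Finset.sum_range_succ' (fun j => ξ j * V n j) q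
    rw [Finset.sum_range_succ] at h2
    have h3 := Finset.sum_range_succ' ξ q
    rw [hξsum] at h3
    rw [hVq] at h2
    rw [h1]
    simp only [hΦ]
    linear_combination -h2 + V n 0 * h3
  have ht : ∀ n : ℕ, ∃ t : ℝ, (n : ℝ) ≤ t ∧ Φ n = -(t * (ξ q * a)) := by
    intro n
    induction n with
    | zero => exact ⟨0, by simp, by simp [hΦ0]⟩
    | succ n ih =>
      obtain ⟨t, ht1, ht2⟩ := ih
      refine ⟨(t + 1) / ρ, ?_, ?_⟩
      · rw [le_div_iff₀ hρpos]
        push_cast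
        have : (0 : ℝ) ≤ n := Nat.cast_nonneg n
        nlinarith
      · have h1 := hΦS n
        rw [ht2] at h1
        have hρc : (ρ : ℂ) ≠ 0 := by exact_mod_cast hρpos.ne'
        push_cast
        apply mul_left_cancel₀ hρc
        rw [h1]
        field_simp
        ring
  have hbound : ∀ n, ‖Φ n‖ ≤ ∑ j ∈ Finset.range q, ‖ξ j‖ * K := by
    intro n
    simp only [hΦ]
    refine norm_sum_le_of_le _ fun j hj => ?_
    have hj := Finset.mem_range.mp hj
    rw [norm_mul]
    exact mul_le_mul_of_nonneg_left (hK n (j + 1) (by omega) (by omega)) (norm_nonneg _)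
  set L := ∑ j ∈ Finset.range q, ‖ξ j‖ * K
  have hpos : 0 < ‖ξ q * a‖ := norm_pos_iff.mpr (mul_ne_zero hξq ha)
  obtain ⟨n, hn⟩ := exists_nat_gt (L / ‖ξ q * a‖)
  obtain ⟨t, ht1, ht2⟩ := ht n
  have h1 := hbound n
  rw [ht2, norm_neg, norm_mul, Complex.norm_real, Real.norm_eq_abs] at h1
  rw [div_lt_iff₀ hpos] at hn
  have h2 : (n : ℝ) ≤ |t| := ht1.trans (le_abs_self t)
  nlinarith

lemma oddMap_deriv (ℓ : ℕ) (c₁ : ℝ) (c : ℕ → ℝ) (i : ℕ) (hx : c i ≠ 0) :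
    ((deriv (oddMap ℓ c₁) (c i) : ℝ) : ℂ) = fd ℓ c i := by
  rcases lt_or_gt_of_ne hx with h | h
  · have h1 : HasDerivAt (fun x : ℝ => (-x) ^ ℓ + c₁) (ℓ * (-c i) ^ (ℓ - 1) * (-1)) (c i) :=
      ((hasDerivAt_neg (c i)).pow ℓ).add_const c₁
    have h2 : oddMap ℓ c₁ =ᶠ[nhds (c i)] (fun x : ℝ => (-x) ^ ℓ + c₁) := by
      filter_upwards [eventually_lt_nhds h] with x hx
      rw [oddMap, abs_of_neg hx]
    rw [(h1.congr_of_eventuallyEq h2).deriv, fd, sg_neg h, abs_of_neg h]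
    push_cast
    ring
  · have h1 : HasDerivAt (fun x : ℝ => x ^ ℓ + c₁) (ℓ * (c i) ^ (ℓ - 1)) (c i) :=
      (hasDerivAt_pow ℓ (c i)).add_const c₁
    have h2 : oddMap ℓ c₁ =ᶠ[nhds (c i)] (fun x : ℝ => x ^ ℓ + c₁) := by
      filter_upwards [eventually_gt_nhds h] with x hx
      rw [oddMap, abs_of_pos hx]
    rw [(h1.congr_of_eventuallyEq h2).deriv, fd, sg_pos h.le, abs_of_pos h]
    push_cast
    ring

lemma orbit_setup (ℓ : ℕ) (h3 : 3 ≤ ℓ) (hodd : Odd ℓ) (q : ℕ) (hq : 1 ≤ q) (c : ℕ → ℝ)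
    (hrec : ∀ i, 1 ≤ i → c (i + 1) = |c i| ^ ℓ + c 1) (hc1 : c 1 < 0)
    (hper : c (q + 1) = 0) (hne : ∀ j, 1 ≤ j → j ≤ q → c j ≠ 0)
    (w : ℝ) (hw : 0 < w) (hwfix : w ^ ℓ + c 1 = -w)
    (havoid : ∀ j, 1 ≤ j → j ≤ q → c j ∉ Set.Ico (-w) 0)
    (hc23 : c 3 < c 2) (hc34 : c 4 < c 3) (hc40 : 0 < c 4) :
    ∃ μ b : ℝ, OrbitData ℓ q c μ b ∧ GoodCfg ℓ q c μ b (fun i => (c i : ℂ)) := by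
  obtain ⟨μ, b, hμ1, hb0, hμ, hb, hb2, hbμ, hsμ⟩ := consts ℓ h3
  have hℓ0 : ℓ ≠ 0 := by omega
  have hc3 : 0 < c 3 := by linarith
  have hc2 : 0 < c 2 := by linarith
  have hq4 : 4 ≤ q := by
    by_contra h
    push Not at h
    interval_cases q <;> norm_num at hper <;> linarith
  have hneg : ∀ i, 1 ≤ i → i ≤ q → c i < 0 → 0 ≤ c (i + 1) := by
    intro i hi hiq hci
    rcases Nat.lt_or_ge i q with h | h
    · have h1 := havoid i hi hiq
      have h2 := havoid (i + 1) (by omega) (by omega)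
      rw [Set.mem_Ico, not_and, not_lt] at h1 h2
      have h4 : c i < -w := by
        by_contra h5
        push Not at h5
        linarith [h1 h5]
      apply h2
      rw [hrec i hi]
      have h6 : w ^ ℓ ≤ |c i| ^ ℓ := by
        gcongr
        rw [abs_of_neg hci]
        linarith
      linarith
    · obtain rfl : i = q := by omega
      rw [hper]
  set C := -c 1 with hC
  have e1 : c 1 = -C := by simp [hC]
  have hCpos : 0 < C := by linarith
  have e2 : c 2 = C ^ ℓ - C := by
    rw [hrec 1 le_rfl, abs_of_neg hc1, e1]; ring
  have e3 : c 3 = c 2 ^ ℓ - C := by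
    rw [hrec 2 (by omega), abs_of_pos hc2, e1]; ring
  have hC1 : 1 < C := by
    by_contra h
    push Not at h
    have := pow_le_of_le_one hCpos.le h hℓ0
    linarith
  have hc21 : 1 < c 2 := by
    by_contra h
    push Not at h
    have := pow_le_one₀ hc2.le h (n := ℓ)
    linarith
  have hμC : μ < C := lt_of_pow_lt_pow_left₀ ℓ hCpos.le (by rw [hμ]; linarith)
  have hc2C : c 2 < C := lt_of_pow_lt_pow_left₀ ℓ hCpos.le (by linarith)
  have hCb : C < b := by
    by_contra h
    push Not at h
    have hs : ∀ x : ℝ, x ^ ℓ = x ^ (ℓ - 1) * x := fun x => (pow_sub_one_mul hℓ0 x).symm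
    have h1 : b ^ (ℓ - 1) = 2 := by
      have := hb
      rw [hs] at this
      exact mul_right_cancel₀ hb0.ne' this
    have h2 : b ^ (ℓ - 1) ≤ C ^ (ℓ - 1) := by gcongr
    have h4 := hs C
    nlinarith
  have habs : ∀ i, 1 ≤ i → |c i| ≤ C := by
    intro i hi
    induction i, hi using Nat.le_induction with
    | base => rw [abs_of_neg hc1]
    | succ i hi ih =>
      have h1 : |c i| ^ ℓ ≤ C ^ ℓ := by gcongr
      have h2 : 0 ≤ |c i| ^ ℓ := by positivity
      rw [hrec i hi, abs_le, e1]
      constructor <;> linarith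
  have hbig : ∀ i, 1 ≤ i → 0 ≤ c (i + 1) → 1 < |c i| := by
    intro i hi h
    rw [hrec i hi] at h
    by_contra h1
    push Not at h1
    have := pow_le_one₀ (abs_nonneg (c i)) h1 (n := ℓ)
    linarith
  refine ⟨μ, b, ⟨h3, hodd, hq4, hrec, hper, hne, hneg, hc1, hc2, hc3, hc40, hμ1, hb0, hμ, hb, hb2,
    hbμ, hsμ⟩, ⟨by simp [hper], ?_, ?_, by simpa using hμC, by norm_num, by simpa using hc21, ?_⟩⟩
  · intro i hi hiq hc
    rw [sg_mul_c]
    have h1 := hbig i hi hc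
    have h2 := habs i hi
    rw [Complex.norm_real, Real.norm_eq_abs, abs_abs, Complex.ofReal_re, Complex.ofReal_im]
    refine ⟨by norm_num; linarith, by nlinarith, by linarith⟩
  · intro i hi hiq hc
    have hi1 : i + 1 ≤ q := by
      by_contra h
      obtain rfl : i = q := by omega
      linarith
    have h1 := hbig (i + 1) (by omega) (hneg (i + 1) (by omega) hi1 hc)
    rw [abs_of_neg hc, hrec i hi] at h1
    have hC2 : C < 2 := by nlinarith
    rw [Complex.norm_real, Real.norm_eq_abs]
    by_contra h
    push Not at h
    have := one_le_pow₀ h (n := ℓ)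
    linarith
  · have hlt : ∀ i j, 1 ≤ i → i < j → j ≤ q + 1 → c i ≠ c j := by
      intro i j hi hij hj heq
      have h1 : ∀ k, c (i + k) = c (j + k) := by
        intro k
        induction k with
        | zero => simpa using heq
        | succ k ih =>
          rw [← add_assoc, ← add_assoc, hrec (i + k) (by omega), hrec (j + k) (by omega), ih]
      have h2 := h1 (q + 1 - j)
      rw [show j + (q + 1 - j) = q + 1 by omega, hper] at h2
      exact hne _ (by omega) (by omega) h2
    intro i j hi hiq hj hjq heq
    have heq' : c i = c j := by exact_mod_cast heq
    rcases lt_trichotomy i j with h | h | h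
    · exact absurd heq' (hlt i j hi h hjq)
    · exact h
    · exact absurd heq'.symm (hlt j i hj h hiq)

theorem stmt7 (ℓ : ℕ) (h3 : 3 ≤ ℓ) (hodd : Odd ℓ) (c₁ : ℝ) (hc1 : c₁ < 0)
    (q : ℕ) (hq : 1 ≤ q)
    -- (i): `f^{q+1}(0) = 0` and `f^j(0) ≠ 0` for `1 ≤ j ≤ q`
    (hper : (oddMap ℓ c₁)^[q + 1] 0 = 0)
    (hne : ∀ j, 1 ≤ j → j ≤ q → (oddMap ℓ c₁)^[j] 0 ≠ 0)
    -- (ii): `−w` is an orientation-reversing fixed point of `f`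
    (w : ℝ) (hw : 0 < w) (hwfix : w ^ ℓ + c₁ = -w)
    -- (iii): `f^j(0) ∉ [−w, 0)` for `1 ≤ j ≤ q`
    (havoid : ∀ j, 1 ≤ j → j ≤ q → (oddMap ℓ c₁)^[j] 0 ∉ Set.Ico (-w) 0)
    -- (iv): with `c_i = f^i(0)`, one has `c₂ > c₃ > c₄ > 0`
    (hc23 : (oddMap ℓ c₁)^[3] 0 < (oddMap ℓ c₁)^[2] 0)
    (hc34 : (oddMap ℓ c₁)^[4] 0 < (oddMap ℓ c₁)^[3] 0)
    (hc40 : 0 < (oddMap ℓ c₁)^[4] 0) :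
    0 < ∑ n ∈ Finset.range (q + 1),
        1 / ∏ k ∈ Finset.range n, deriv (oddMap ℓ c₁) ((oddMap ℓ c₁)^[k] c₁) := by
  have hf0 : oddMap ℓ c₁ 0 = c₁ := by
    simp [oddMap, zero_pow (show ℓ ≠ 0 by omega)]
  have hck : ∀ k, (oddMap ℓ c₁)^[k] c₁ = (oddMap ℓ c₁)^[k + 1] 0 := by
    intro k
    rw [Function.iterate_succ_apply, hf0]
  have hcc1 : (oddMap ℓ c₁)^[1] 0 = c₁ := by rw [Function.iterate_one, hf0]
  obtain ⟨μ, b, H, hgc⟩ := orbit_setup ℓ h3 hodd q hq (fun i => (oddMap ℓ c₁)^[i] 0)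
    (by
      intro i hi
      show (oddMap ℓ c₁)^[i + 1] 0 = _ + (oddMap ℓ c₁)^[1] 0
      rw [Function.iterate_succ_apply', hcc1]
      rfl)
    (by show (oddMap ℓ c₁)^[1] 0 < 0; rw [hcc1]; exact hc1)
    hper hne w hw (by show _ + (oddMap ℓ c₁)^[1] 0 = _; rw [hcc1]; exact hwfix)
    havoid hc23 hc34 hc40
  have := core H hgc (fun i => deriv (oddMap ℓ c₁) ((oddMap ℓ c₁)^[i] 0))
    (fun i hi hiq => oddMap_deriv ℓ c₁ (fun i => (oddMap ℓ c₁)^[i] 0) i (hne i hi hiq))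
  simp only [hck]
  exact this
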